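/- If μ is an atomless finite Borel measure on [0,1), then for every b > 0 the set {n ∈ ℤ : |μ̂(n)| > b} has density zero in ℤ, i.e. (1/(2N+1)) · #{n : |n| ≤ N, |μ̂(n)| > b} → 0 as N → ∞. -/

import Mathlib

open MeasureTheory Filter

/-- The `n`-th Fourier coefficient of a (finite Borel) measure `μ` on `[0,1)`,
viewed as a measure on the circle `ℝ/ℤ`:  `μ̂(n) = ∫ e^{-2πi n x} dμ(x)`. -/
noncomputable def fourierCoeffM (μ : Measure ℝ) (n : ℤ) : ℂ :=
  ∫ x, Complex.exp (-(2 * Real.pi * Complex.I * (n : ℂ) * (x : ℂ))) ∂μ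

/-- The sum of a geometric progression over a symmetric interval of integers, in product form. -/
theorem sub_one_mul_sum_zpow_Icc {K : Type*} [Field K] {z : K} (hz : z ≠ 0) (N : ℕ) :
    (z - 1) * ∑ n ∈ Finset.Icc (-(N : ℤ)) N, z ^ n = z ^ ((N : ℤ) + 1) - z ^ (-(N : ℤ)) := by
  induction N with
  | zero => simp
  | succ N ih =>
    push_cast
    rw [Finset.sum_Icc_succ_eq_add_endpoints, mul_add, ih, zpow_add₀ hz ((N : ℤ) + 1) 1,
      neg_add, zpow_add₀ hz (-(N : ℤ)) (-1), zpow_add₀ hz (N : ℤ) 1]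
    simp only [zpow_one, zpow_neg]
    field_simp
    ring

theorem norm_two_mul_natCast_add_one (N : ℕ) : ‖2 * (N : ℂ) + 1‖ = 2 * (N : ℝ) + 1 := by
  exact_mod_cast Complex.norm_natCast (2 * N + 1)

/-- The averages of the integer powers of a complex number `z ≠ 1` of modulus one tend to zero. -/
theorem tendsto_average_zpow {z : ℂ} (hz : ‖z‖ = 1) (hz1 : z ≠ 1) :
    Tendsto (fun N : ℕ => (∑ n ∈ Finset.Icc (-(N : ℤ)) N, z ^ n) / (2 * (N : ℂ) + 1))
      atTop (nhds 0) := by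
  have hz0 : z ≠ 0 := norm_ne_zero_iff.mp (by simp [hz])
  have hpos : 0 < ‖z - 1‖ := norm_pos_iff.mpr (sub_ne_zero.mpr hz1)
  have hlim : Tendsto (fun N : ℕ => (2 / ‖z - 1‖) / (2 * (N : ℝ) + 1)) atTop (nhds 0) :=
    (tendsto_atTop_add_const_right _ _
      (tendsto_natCast_atTop_atTop.const_mul_atTop two_pos)).const_div_atTop _
  refine squeeze_zero_norm (fun N => ?_) hlim
  rw [norm_div, norm_two_mul_natCast_add_one]
  gcongr
  rw [le_div_iff₀ hpos, mul_comm, ← norm_mul, sub_one_mul_sum_zpow_Icc hz0]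
  refine (norm_sub_le _ _).trans ?_
  simp only [norm_zpow, hz, one_zpow]
  norm_num

/-- The phase `e^{-2πi (x - y)}` of a pair `(x, y)` of points of the line. -/
noncomputable def differencePhase (p : ℝ × ℝ) : ℂ :=
  Complex.exp (-(2 * Real.pi * Complex.I * ((p.1 : ℂ) - p.2)))

theorem continuous_differencePhase : Continuous differencePhase := by
  unfold differencePhase
  fun_prop

theorem norm_differencePhase (p : ℝ × ℝ) : ‖differencePhase p‖ = 1 := by
  simp [differencePhase, Complex.norm_exp]

theorem differencePhase_ne_one {p : ℝ × ℝ} (h1 : p.1 ∈ Set.Ico (0 : ℝ) 1)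
    (h2 : p.2 ∈ Set.Ico (0 : ℝ) 1) (hne : p.1 ≠ p.2) : differencePhase p ≠ 1 := by
  intro h
  obtain ⟨n, hn⟩ := Complex.exp_eq_one_iff.mp h
  have hn' : (p.2 : ℂ) - p.1 = n :=
    mul_right_cancel₀ Complex.two_pi_I_ne_zero (by linear_combination hn)
  have hr : p.2 - p.1 = n := by exact_mod_cast hn'
  have hlt : (n : ℝ) < 1 := by linarith [h1.1, h2.2]
  have hgt : (-1 : ℝ) < n := by linarith [h2.1, h1.2]
  have hlt' : n < 1 := by exact_mod_cast hlt
  have hgt' : -1 < n := by exact_mod_cast hgt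
  have hn0 : n = 0 := by omega
  rw [hn0, Int.cast_zero] at hr
  exact hne (by linarith)

theorem integrable_differencePhase_zpow (μ : Measure ℝ) [IsFiniteMeasure μ] (n : ℤ) :
    Integrable (fun p => differencePhase p ^ n) (μ.prod μ) := by
  refine Integrable.of_bound (C := 1) ?_ (ae_of_all _ fun p => by simp [norm_differencePhase])
  exact (continuous_differencePhase.zpow₀ n fun p =>
    Or.inl (Complex.exp_ne_zero _)).aestronglyMeasurable

theorem norm_fourierCoeffM_sq (μ : Measure ℝ) [IsFiniteMeasure μ] (n : ℤ) :
    ((‖fourierCoeffM μ n‖ ^ 2 : ℝ) : ℂ) = ∫ p, differencePhase p ^ n ∂μ.prod μ := by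
  push_cast
  rw [← Complex.mul_conj', fourierCoeffM, ← integral_conj, ← integral_prod_mul]
  refine integral_congr_ae (ae_of_all _ fun p => ?_)
  simp only [differencePhase]
  rw [← Complex.exp_conj, ← Complex.exp_add, ← Complex.exp_int_mul]
  congr 1
  simp only [map_neg, map_mul, Complex.conj_ofReal, Complex.conj_I, map_ofNat, map_intCast]
  ring

theorem ae_differencePhase_ne_one (μ : Measure ℝ) [IsFiniteMeasure μ]
    (hsupp : μ (Set.Ico (0 : ℝ) 1)ᶜ = 0) (hatomless : ∀ x : ℝ, μ {x} = 0) :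
    ∀ᵐ p ∂μ.prod μ, differencePhase p ≠ 1 := by
  have hmem : ∀ᵐ x ∂μ, x ∈ Set.Ico (0 : ℝ) 1 := hsupp
  have hdiag : ∀ᵐ p ∂μ.prod μ, p.1 ≠ p.2 := by
    refine Measure.ae_prod_iff_ae_ae (measurableSet_eq_fun measurable_fst measurable_snd).compl
      |>.mpr (ae_of_all _ fun x => ?_)
    filter_upwards [compl_mem_ae_iff.mpr (hatomless x)] with y hy
    exact fun h => hy h.symm
  filter_upwards [Measure.quasiMeasurePreserving_fst.ae hmem,
    Measure.quasiMeasurePreserving_snd.ae hmem, hdiag] with p h1 h2 hne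
  exact differencePhase_ne_one h1 h2 hne

/-- **Wiener's lemma** for an atomless measure: the mean of the squared moduli of the Fourier
coefficients vanishes. -/
theorem tendsto_average_norm_fourierCoeffM_sq (μ : Measure ℝ) [IsFiniteMeasure μ]
    (hsupp : μ (Set.Ico (0 : ℝ) 1)ᶜ = 0) (hatomless : ∀ x : ℝ, μ {x} = 0) :
    Tendsto (fun N : ℕ =>
        (∑ n ∈ Finset.Icc (-(N : ℤ)) N, ‖fourierCoeffM μ n‖ ^ 2) / (2 * (N : ℝ) + 1))
      atTop (nhds 0) := by
  have hint (N : ℕ) : Integrable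
      (fun p => (∑ n ∈ Finset.Icc (-(N : ℤ)) N, differencePhase p ^ n) / (2 * (N : ℂ) + 1))
      (μ.prod μ) :=
    (integrable_finsetSum _ fun n _ => integrable_differencePhase_zpow μ n).div_const _
  have hlim : Tendsto (fun N : ℕ => ∫ p, (∑ n ∈ Finset.Icc (-(N : ℤ)) N, differencePhase p ^ n) /
      (2 * (N : ℂ) + 1) ∂μ.prod μ) atTop (nhds (∫ _, (0 : ℂ) ∂μ.prod μ)) := by
    refine tendsto_integral_of_dominated_convergence (fun _ => 1)
      (fun N => (hint N).aestronglyMeasurable) (integrable_const _)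
      (fun N => ae_of_all _ fun p => ?_) ?_
    · rw [norm_div, norm_two_mul_natCast_add_one, div_le_one (by positivity)]
      refine (norm_sum_le _ _).trans ?_
      simp only [norm_zpow, norm_differencePhase, one_zpow, Finset.sum_const, Int.card_Icc,
        nsmul_eq_mul, mul_one]
      have hcard : ((N : ℤ) + 1 - -(N : ℤ)).toNat = 2 * N + 1 := by omega
      rw [hcard]
      push_cast
      rfl
    · filter_upwards [ae_differencePhase_ne_one μ hsupp hatomless] with p hp
      exact tendsto_average_zpow (norm_differencePhase p) hp
  rw [integral_zero, ← Complex.ofReal_zero] at hlim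
  refine tendsto_ofReal_iff.mp (hlim.congr fun N => ?_)
  rw [integral_div, integral_finsetSum _ fun n _ => integrable_differencePhase_zpow μ n]
  simp only [← norm_fourierCoeffM_sq]
  push_cast
  rfl

open scoped Classical in
/-- If `μ` is an atomless finite Borel measure on `[0,1)`, then for every `b > 0` the set
`{n ∈ ℤ : |μ̂(n)| > b}` has density zero in `ℤ`:
`(1/(2N+1)) · #{n : |n| ≤ N, |μ̂(n)| > b} → 0` as `N → ∞`. -/
theorem stmt_9 (μ : Measure ℝ) [IsFiniteMeasure μ]
    (hsupp : μ (Set.Ico (0:ℝ) 1)ᶜ = 0) (hatomless : ∀ x : ℝ, μ {x} = 0)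
    (b : ℝ) (hb : 0 < b) :
    Tendsto (fun N : ℕ =>
        (((Finset.Icc (-(N : ℤ)) (N : ℤ)).filter
            (fun n => b < ‖fourierCoeffM μ n‖)).card : ℝ) / (2 * (N : ℝ) + 1))
      atTop (nhds 0) := by
  have hlim := (tendsto_average_norm_fourierCoeffM_sq μ hsupp hatomless).div_const (b ^ 2)
  rw [zero_div] at hlim
  refine squeeze_zero (fun N => by positivity) (fun N => ?_) hlim
  rw [div_right_comm]
  gcongr
  rw [le_div_iff₀ (by positivity), ← nsmul_eq_mul]
  calc _ ≤ ∑ n ∈ (Finset.Icc (-(N : ℤ)) (N : ℤ)).filter (fun n => b < ‖fourierCoeffM μ n‖),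
        ‖fourierCoeffM μ n‖ ^ 2 := by
        refine Finset.card_nsmul_le_sum _ _ _ fun n hn => ?_
        have := (Finset.mem_filter.mp hn).2
        gcongr
    _ ≤ _ := Finset.sum_le_sum_of_subset_of_nonneg (Finset.filter_subset _ _)
        fun _ _ _ => by positivity
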